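/- Let f : ℝ² → ℝ be defined by f(x) = ln(1 − ln|x|) for 0 < |x| ≤ 1 and f(x) = 0 for |x| ≥ 1. Then |∇f(x)| ≤ C/(|x|(1 − ln|x|)) for 0 < |x| < 1, and for every r ∈ (0, 1/2], r^{-1} ∫₀^r dη/(1 − ln η) ≤ C'/(1 − ln r). Consequently, via the Poincaré inequality avg_B|f − avg_B f| ≲ r avg_B|∇f|, the function f belongs to Lᵅmo for every α ∈ [0,1]. -/

import Mathlib

open Real Set MeasureTheory Metric

/-- The radial profile. -/
noncomputable def llG (t : ℝ) : ℝ := if t ≤ 1 then Real.log (1 - Real.log t) else 0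

/-- The radial weight `r / t` cut off at `r`. -/
noncomputable def llW (r t : ℝ) : ℝ := if t < r then r / t else 0

lemma llG_min (t : ℝ) : llG t = Real.log (1 - Real.log (min t 1)) := by
  unfold llG
  split_ifs with h
  · rw [min_eq_left h]
  · rw [min_eq_right (not_le.mp h).le]; simp

lemma ll_deriv (t : ℝ) (h0 : 0 < t) (h1 : t ≤ 1) :
    HasDerivAt (fun t => Real.log (1 - Real.log t)) (-(t * (1 - Real.log t))⁻¹) t := by
  have hl := Real.log_nonpos h0.le h1
  have h := ((Real.hasDerivAt_log h0.ne').const_sub 1).log (by linarith)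
  convert h using 1
  rw [mul_inv]; ring

lemma ll_mono (r t : ℝ) (hr : 0 < r) (hrt : r ≤ t) (h1 : t ≤ 1) :
    r * (1 - Real.log r) ≤ t * (1 - Real.log t) := by
  have ht : 0 < t := by linarith
  have hl := Real.log_nonpos ht.le h1
  have h := Real.log_le_sub_one_of_pos (div_pos ht hr)
  rw [Real.log_div ht.ne' hr.ne'] at h
  have h2 : r * (Real.log t - Real.log r) ≤ t - r := by
    have := mul_le_mul_of_nonneg_left h hr.le
    have e : r * (t / r - 1) = t - r := by field_simp
    linarith
  nlinarith [mul_nonneg (sub_nonneg.2 hrt) (neg_nonneg.2 hl)]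

lemma llG_lip (r s t : ℝ) (hr : 0 < r) (hr1 : r ≤ 1) (hs : r ≤ s) (ht : r ≤ t) :
    |llG s - llG t| ≤ (r * (1 - Real.log r))⁻¹ * |s - t| := by
  have hL : 0 < 1 - Real.log r := by linarith [Real.log_nonpos hr.le hr1]
  rw [llG_min, llG_min]
  have h := Convex.norm_image_sub_le_of_norm_hasDerivWithin_le (𝕜 := ℝ)
    (f := fun t => Real.log (1 - Real.log t)) (f' := fun t => -(t * (1 - Real.log t))⁻¹)
    (s := Icc r 1) (x := min t 1) (y := min s 1) (C := (r * (1 - Real.log r))⁻¹)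
    (fun x hx => (ll_deriv x (hr.trans_le hx.1) hx.2).hasDerivWithinAt)
    (fun x hx => by
      have := ll_mono r x hr hx.1 hx.2
      have hp : 0 < r * (1 - Real.log r) := by positivity
      rw [norm_neg, norm_inv, Real.norm_of_nonneg (hp.le.trans this)]
      exact inv_anti₀ hp this)
    (convex_Icc r 1) ⟨le_min ht hr1, min_le_right _ _⟩ ⟨le_min hs hr1, min_le_right _ _⟩
  refine h.trans ?_
  gcongr
  have := abs_min_sub_min_le_max s 1 t 1
  simpa using this

lemma llG_small (r t : ℝ) (hr1 : r ≤ 1) (ht : 0 < t) (htr : t < r) :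
    |llG t - llG r| ≤ (1 - Real.log r)⁻¹ * (r / t) := by
  have hr : 0 < r := ht.trans htr
  have hL : 0 < 1 - Real.log r := by linarith [Real.log_nonpos hr.le hr1]
  have hlt := Real.log_lt_log ht htr
  unfold llG
  rw [if_pos (htr.le.trans hr1), if_pos hr1, ← Real.log_div (by linarith) hL.ne']
  have h1 : 1 ≤ (1 - Real.log t) / (1 - Real.log r) := by
    rw [le_div_iff₀ hL]; linarith
  rw [abs_of_nonneg (Real.log_nonneg h1)]
  refine (Real.log_le_sub_one_of_pos (by linarith)).trans ?_
  have h := Real.log_le_sub_one_of_pos (div_pos hr ht)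
  rw [Real.log_div hr.ne' ht.ne'] at h
  have e : (1 - Real.log t) / (1 - Real.log r) - 1
      = (1 - Real.log r)⁻¹ * (Real.log r - Real.log t) := by field_simp; ring
  rw [e]
  gcongr
  linarith

/-- Main pointwise estimate. -/
lemma ll_pointwise (r m t : ℝ) (hr : 0 < r) (hr1 : r ≤ 1) (ht : 0 < t) (h : |t - m| ≤ r) :
    |llG t - llG (max m r)| ≤ (1 - Real.log r)⁻¹ * (1 + llW r t) ∧ 0 ≤ llW r t := by
  have hL : 0 < 1 - Real.log r := by linarith [Real.log_nonpos hr.le hr1]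
  have hab := abs_le.1 h
  have key : ∀ d, |d| ≤ r → (r * (1 - Real.log r))⁻¹ * |d| ≤ (1 - Real.log r)⁻¹ := by
    intro d hd
    calc (r * (1 - Real.log r))⁻¹ * |d| ≤ (r * (1 - Real.log r))⁻¹ * r := by gcongr
      _ = _ := by field_simp
  unfold llW
  split_ifs with htr
  · refine ⟨?_, by positivity⟩
    have h1 := llG_small r t hr1 ht htr
    have h2 := llG_lip r r (max m r) hr hr1 le_rfl (le_max_right _ _)
    have h3 := key (r - max m r) (by
      rw [abs_le]; rcases max_cases m r with ⟨e, _⟩ | ⟨e, _⟩ <;> rw [e] <;> constructor <;> linarith)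
    have h4 := abs_sub_le (llG t) (llG r) (llG (max m r))
    rw [mul_add]; linarith
  · refine ⟨?_, le_rfl⟩
    have h2 := llG_lip r t (max m r) hr hr1 (not_lt.1 htr) (le_max_right _ _)
    have h3 := key (t - max m r) (by
      rw [abs_le]; rcases max_cases m r with ⟨e, _⟩ | ⟨e, _⟩ <;> rw [e] <;> constructor <;> linarith)
    simpa using h2.trans h3

lemma llW_eq (r : ℝ) : EqOn (fun y : ℝ => y ^ (Module.finrank ℝ (EuclideanSpace ℝ (Fin 2)) - 1) • llW r y)
    ((Iio r).indicator (fun _ => r)) (Ioi 0) := by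
  intro y hy
  have hy' : y ≠ 0 := ne_of_gt hy
  by_cases h : y < r
  · simp [llW, h]; field_simp
  · simp [llW, h]

lemma llW_integrable (r : ℝ) : Integrable (fun x : EuclideanSpace ℝ (Fin 2) => llW r ‖x‖) := by
  rw [integrable_fun_norm_addHaar]
  rw [integrableOn_congr_fun (llW_eq r) measurableSet_Ioi]
  rw [IntegrableOn, integrable_indicator_iff measurableSet_Iio, IntegrableOn,
    Measure.restrict_restrict measurableSet_Iio]
  refine integrableOn_const (hs := ?_)
  rw [inter_comm, Ioi_inter_Iio]; simp

lemma llW_integral (r : ℝ) (hr : 0 < r) : ∫ x : EuclideanSpace ℝ (Fin 2), llW r ‖x‖ =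
    2 * (volume.real (ball (0 : EuclideanSpace ℝ (Fin 2)) 1) * r ^ 2) := by
  rw [integral_fun_norm_addHaar, setIntegral_congr_fun measurableSet_Ioi (llW_eq r),
    integral_indicator measurableSet_Iio, Measure.restrict_restrict measurableSet_Iio,
    inter_comm, Ioi_inter_Iio]
  simp [hr.le]
  left; ring

lemma ll_vol (c : EuclideanSpace ℝ (Fin 2)) (r : ℝ) (hr : 0 < r) : volume.real (ball c r) =
    volume.real (ball (0 : EuclideanSpace ℝ (Fin 2)) 1) * r ^ 2 := by
  rw [Measure.real, Measure.addHaar_ball_of_pos _ _ hr, ENNReal.toReal_mul, Measure.real,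
    ENNReal.toReal_ofReal (by positivity)]
  simp [mul_comm]

lemma llG_meas : Measurable llG := by
  unfold llG
  exact Measurable.ite measurableSet_Iic (by fun_prop) measurable_const

lemma llG_integrable : Integrable (fun x : EuclideanSpace ℝ (Fin 2) => llG ‖x‖) := by
  refine (llW_integrable 1).mono' (llG_meas.comp measurable_norm).aestronglyMeasurable ?_
  filter_upwards [Measure.ae_ne volume (0 : EuclideanSpace ℝ (Fin 2))] with x hx
  have hx0 : 0 < ‖x‖ := norm_pos_iff.2 hx
  have g1 : llG 1 = 0 := by simp [llG]
  by_cases h : ‖x‖ < 1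
  · have := llG_small 1 ‖x‖ le_rfl hx0 h
    simpa [llW, h, g1] using this
  · rw [llG_min, min_eq_right (not_lt.1 h)]; simp [llW, h]

lemma ll_avg (c : EuclideanSpace ℝ (Fin 2)) (r : ℝ) (hr : 0 < r) (hr1 : r ≤ 1) :
    ⨍ y in ball c r, |llG ‖y‖ - ⨍ z in ball c r, llG ‖z‖| ≤ 6 * (1 - Real.log r)⁻¹ := by
  have hL : 0 < 1 - Real.log r := by linarith [Real.log_nonpos hr.le hr1]
  set V := volume.real (ball c r) with hV
  have hVpos : 0 < V := by
    rw [hV]; exact ENNReal.toReal_pos (measure_ball_pos _ _ hr).ne' measure_ball_lt_top.ne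
  have hfin : IsFiniteMeasure (volume.restrict (ball c r)) :=
    ⟨by simpa using (measure_ball_lt_top (x := c) (r := r) (μ := volume))⟩
  set a := llG (max ‖c‖ r) with ha
  have hf : Integrable (fun x => llG ‖x‖) (volume.restrict (ball c r)) :=
    llG_integrable.restrict
  have hfa : Integrable (fun x => |llG ‖x‖ - a|) (volume.restrict (ball c r)) :=
    (hf.sub (integrable_const a)).abs
  have hb : ∫ y in ball c r, |llG ‖y‖ - a| ≤ (1 - Real.log r)⁻¹ * (3 * V) := by
    have hg : Integrable (fun y => (1 - Real.log r)⁻¹ * (1 + llW r ‖y‖))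
        (volume.restrict (ball c r)) :=
      (((integrable_const 1).add (llW_integrable r).restrict).const_mul _)
    have h1 : ∫ y in ball c r, |llG ‖y‖ - a| ≤
        ∫ y in ball c r, (1 - Real.log r)⁻¹ * (1 + llW r ‖y‖) := by
      refine integral_mono_ae hfa hg ?_
      filter_upwards [ae_restrict_mem measurableSet_ball,
        ae_restrict_of_ae (Measure.ae_ne volume (0 : EuclideanSpace ℝ (Fin 2)))] with y hy hy0
      refine (ll_pointwise r ‖c‖ ‖y‖ hr hr1 (norm_pos_iff.2 hy0) ?_).1
      refine (abs_norm_sub_norm_le y c).trans ?_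
      rw [← dist_eq_norm]; exact (mem_ball.1 hy).le
    refine h1.trans ?_
    rw [integral_const_mul, integral_add (integrable_const 1) (llW_integrable r).restrict]
    have h2 : ∫ y in ball c r, llW r ‖y‖ ≤ 2 * V := by
      rw [hV, ll_vol c r hr, ← llW_integral r hr]
      refine setIntegral_le_integral (llW_integrable r) (Filter.Eventually.of_forall fun x => ?_)
      simp only [llW, Pi.zero_apply]
      split_ifs <;> positivity
    have h3 : ∫ y in ball c r, (1:ℝ) = V := by simp [hV]
    rw [h3]
    gcongr
    linarith
  set m := ⨍ z in ball c r, llG ‖z‖ with hm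
  have hma : |a - m| ≤ V⁻¹ * ∫ y in ball c r, |llG ‖y‖ - a| := by
    have e : m - a = V⁻¹ * ∫ y in ball c r, (llG ‖y‖ - a) := by
      rw [integral_sub hf (integrable_const a), hm, setAverage_eq, ← hV]
      simp only [smul_eq_mul, integral_const, measureReal_restrict_apply_univ, ← hV]
      field_simp
    rw [abs_sub_comm, e, abs_mul, abs_of_pos (inv_pos.2 hVpos)]
    gcongr
    exact abs_integral_le_integral_abs
  rw [setAverage_eq, ← hV, smul_eq_mul]
  have h5 : ∫ y in ball c r, |llG ‖y‖ - m| ≤ (∫ y in ball c r, |llG ‖y‖ - a|) + V * |a - m| := by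
    have : V * |a - m| = ∫ y in ball c r, |a - m| := by simp [hV]
    rw [this, ← integral_add hfa (integrable_const _)]
    refine integral_mono (hf.sub (integrable_const m)).abs (hfa.add (integrable_const _)) ?_
    intro y
    exact abs_sub_le _ _ _
  set I := ∫ y in ball c r, |llG ‖y‖ - a|
  have h6 : V * |a - m| ≤ I := by
    calc V * |a - m| ≤ V * (V⁻¹ * I) := by gcongr
      _ = I := by field_simp
  calc V⁻¹ * ∫ y in ball c r, |llG ‖y‖ - m| ≤ V⁻¹ * (6 * (1 - Real.log r)⁻¹ * V) := by
        gcongr; linarith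
    _ = _ := by field_simp

theorem loglog_example_in_Lamo :
    let f : EuclideanSpace ℝ (Fin 2) → ℝ :=
      fun x => if ‖x‖ ≤ 1 then Real.log (1 - Real.log ‖x‖) else 0
    (∃ C > (0:ℝ), ∀ x : EuclideanSpace ℝ (Fin 2), 0 < ‖x‖ → ‖x‖ < 1 →
        ‖fderiv ℝ f x‖ ≤ C / (‖x‖ * (1 - Real.log ‖x‖))) ∧
    (∃ C' > (0:ℝ), ∀ r : ℝ, 0 < r → r ≤ 1/2 →
        r⁻¹ * ∫ η in (0:ℝ)..r, (1 - Real.log η)⁻¹ ≤ C' / (1 - Real.log r)) ∧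
    (∀ α ∈ Set.Icc (0:ℝ) 1, ∃ M : ℝ,
        (∀ (c : EuclideanSpace ℝ (Fin 2)) (r : ℝ), 0 < r → r ≤ 1/2 →
          |Real.log r| ^ α *
            ⨍ y in ball c r, |f y - ⨍ z in ball c r, f z| ≤ M) ∧
        (∀ (c : EuclideanSpace ℝ (Fin 2)) (r : ℝ), 0 < r →
          volume (ball c r) = 1 → ∫ y in ball c r, |f y| ≤ M)) := by
  intro f
  have hfG : f = fun x => llG ‖x‖ := rfl
  refine ⟨⟨1, one_pos, ?_⟩, ⟨1, one_pos, ?_⟩, ?_⟩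
  · intro x hx0 hx1
    have hL : 0 < 1 - Real.log ‖x‖ := by linarith [Real.log_nonpos hx0.le hx1.le]
    have hev : f =ᶠ[nhds x] (fun t => Real.log (1 - Real.log t)) ∘ norm := by
      filter_upwards [continuous_norm.continuousAt.eventually (gt_mem_nhds hx1)] with y hy
      have hy' : ‖y‖ ≤ 1 := le_of_lt hy
      simp [f, hy']
    have hd : DifferentiableAt ℝ (norm : EuclideanSpace ℝ (Fin 2) → ℝ) x :=
      DifferentiableAt.norm ℝ differentiableAt_id (norm_pos_iff.1 hx0)
    have h := (ll_deriv ‖x‖ hx0 hx1.le).comp_hasFDerivAt x hd.hasFDerivAt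
    rw [hev.fderiv_eq, h.fderiv, norm_smul, norm_neg, norm_inv,
      Real.norm_of_nonneg (by positivity), one_div]
    have hn : ‖fderiv ℝ (norm : EuclideanSpace ℝ (Fin 2) → ℝ) x‖ ≤ 1 := by
      simpa using norm_fderiv_le_of_lipschitz ℝ (x₀ := x)
        (lipschitzWith_one_norm (E := EuclideanSpace ℝ (Fin 2)))
    exact mul_le_of_le_one_right (by positivity) hn
  · intro r hr hr2
    have hL : 0 < 1 - Real.log r := by linarith [Real.log_nonpos hr.le (by linarith)]
    have h := intervalIntegral.norm_integral_le_of_norm_le_const (a := 0) (b := r)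
      (C := (1 - Real.log r)⁻¹) (f := fun η => (1 - Real.log η)⁻¹) (by
        intro η hη
        rw [uIoc_of_le hr.le] at hη
        have := Real.log_le_log hη.1 hη.2
        rw [norm_inv, Real.norm_of_nonneg (by linarith)]
        exact inv_anti₀ hL (by linarith))
    rw [sub_zero, abs_of_pos hr] at h
    calc r⁻¹ * ∫ η in (0:ℝ)..r, (1 - Real.log η)⁻¹ ≤ r⁻¹ * ((1 - Real.log r)⁻¹ * r) := by
          gcongr
          exact (le_abs_self _).trans h
      _ = _ := by field_simp
  · intro α hα
    refine ⟨max 6 (∫ y, |f y|), ?_, ?_⟩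
    · intro c r hr hr2
      refine le_trans ?_ (le_max_left _ _)
      have hl := Real.log_nonpos hr.le (by linarith)
      have hL : 0 < 1 - Real.log r := by linarith
      have h1 : |Real.log r| ^ α ≤ 1 - Real.log r := by
        calc |Real.log r| ^ α ≤ (1 - Real.log r) ^ α := by
              apply Real.rpow_le_rpow (abs_nonneg _) _ hα.1
              rw [abs_of_nonpos hl]; linarith
          _ ≤ (1 - Real.log r) ^ (1:ℝ) :=
              Real.rpow_le_rpow_of_exponent_le (by linarith) hα.2
          _ = _ := Real.rpow_one _
      have h2 := ll_avg c r hr (by linarith)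
      have h3 : |Real.log r| ^ α * ⨍ y in ball c r, |f y - ⨍ z in ball c r, f z| ≤
          |Real.log r| ^ α * (6 * (1 - Real.log r)⁻¹) :=
        mul_le_mul_of_nonneg_left h2 (by positivity)
      refine h3.trans ?_
      calc |Real.log r| ^ α * (6 * (1 - Real.log r)⁻¹)
          ≤ (1 - Real.log r) * (6 * (1 - Real.log r)⁻¹) := by gcongr
        _ = 6 := by field_simp
    · intro c r hr _
      refine le_trans ?_ (le_max_right _ _)
      refine setIntegral_le_integral ?_ (Filter.Eventually.of_forall fun x => abs_nonneg _)
      rw [hfG]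
      exact llG_integrable.abs
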